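/- arXiv:1703.06111 — 7 statements merged into one kernel-verified Lean document; each statement's English description precedes it below -/
import Mathlib

section
/- For integers k ≥ 2 and n ≥ k+2, the following are equivalent: (i) S_{n,k} is a Cayley graph; (ii) there is a subgroup G ≤ S_n × S_{k−1} such that the map ε: G → V(S_{n,k}) sending (μ,ν) to the vertex overline{μν⁻¹} = [μ(ν⁻¹(1)),…,μ(ν⁻¹(k))] is bijective; (iii) there is a subgroup G ≤ S_n × S_{k−1} with |G| = n!/(n−k)! such that, for the action of G on V(S_{n,k}) given by φ, the stabilizer of the vertex ē = [1,2,…,k] is trivial. -/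
open Equiv

/-- Vertices of the `(n,k)`-star graph: `k`-permutations of an `n`-set, i.e.
ordered `k`-tuples of distinct elements (positions and values are `0`-indexed,
so "position 1" of the paper is the index `j : Fin k` with `j.1 = 0`). -/
def StarVertex (n k : ℕ) : Type :=
  {a : Fin k → Fin n // Function.Injective a}

/-- `u` and `v` are joined by a residual edge: they differ exactly in position 1. -/
def IsResEdge {n k : ℕ} (u v : StarVertex n k) : Prop :=
  (∀ j : Fin k, j.1 = 0 → u.1 j ≠ v.1 j) ∧ ∀ j : Fin k, j.1 ≠ 0 → u.1 j = v.1 j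

/-- `u` and `v` are joined by a star edge: `v` is obtained from `u` by exchanging
the entries in position 1 and position `i` for some position `i ≠ 1`. -/
def IsStarEdge {n k : ℕ} (u v : StarVertex n k) : Prop :=
  ∃ i : Fin k, i.1 ≠ 0 ∧
    (∀ j : Fin k, j.1 = 0 → v.1 j = u.1 i ∧ v.1 i = u.1 j) ∧
    ∀ j : Fin k, j.1 ≠ 0 → j ≠ i → v.1 j = u.1 j

/-- The `(n,k)`-star graph `S_{n,k}`. -/
def starGraph (n k : ℕ) : SimpleGraph (StarVertex n k) :=
  SimpleGraph.fromRel fun u v => IsStarEdge u v ∨ IsResEdge u v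

/-- A (finite) graph is a Cayley graph if it is isomorphic to the Cayley graph of some
finite group `G` with connection set `S ⊆ G` satisfying `1 ∉ S` and `S = S⁻¹`. -/
def IsCayleyGraph {V : Type*} (Γ : SimpleGraph V) : Prop :=
  ∃ (G : Type) (_ : Group G) (_ : Fintype G) (S : Set G),
    (1 : G) ∉ S ∧ (∀ s ∈ S, s⁻¹ ∈ S) ∧
    Nonempty (Γ ≃g SimpleGraph.fromRel fun g h : G => g⁻¹ * h ∈ S)

/-- The automorphism group of a graph, as a subgroup of the permutation group
of the vertex set. -/
def graphAut {V : Type*} (Γ : SimpleGraph V) : Subgroup (Equiv.Perm V) where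
  carrier := {σ | ∀ u w : V, Γ.Adj (σ u) (σ w) ↔ Γ.Adj u w}
  one_mem' := by intro u w; simp
  mul_mem' := by
    intro a b ha hb u w
    rw [Equiv.Perm.mul_apply, Equiv.Perm.mul_apply, ha, hb]
  inv_mem' := by
    intro a ha u w
    simpa using (ha (a⁻¹ u) (a⁻¹ w)).symm

/-- The copy of `S_{k-1}` inside the symmetric group on the `k` positions:
permutations of the positions `2,…,k` fixing position `1`. (Via the further
identification of positions `2,…,k` with the corresponding points, this is the
subgroup `S_{k-1} ≤ S_n` of the paper.) -/
def SkSub (k : ℕ) : Subgroup (Equiv.Perm (Fin k)) where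
  carrier := {ν | ∀ j : Fin k, j.1 = 0 → ν j = j}
  one_mem' := by intro j hj; simp
  mul_mem' := by
    intro a b ha hb j hj
    rw [Equiv.Perm.mul_apply, hb j hj, ha j hj]
  inv_mem' := by
    intro a ha j hj
    have h : a⁻¹ (a j) = j := by simp
    rwa [ha j hj] at h

/-- The vertex `ē = [1,2,…,k]` of `S_{n,k}`. -/
def eVert (n k : ℕ) (h : k ≤ n) : StarVertex n k :=
  ⟨fun j => ⟨j.1, lt_of_lt_of_le j.2 h⟩, fun a b hab => Fin.ext (by simpa using congrArg Fin.val hab)⟩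

/-- The action `φ(μ,ν)` on vertices: `[a_1,…,a_k] ↦ [μ(a_{ν⁻¹(1)}),…,μ(a_{ν⁻¹(k)})]`. -/
def phi (n k : ℕ) (μ : Equiv.Perm (Fin n)) (ν : Equiv.Perm (Fin k))
    (a : StarVertex n k) : StarVertex n k :=
  ⟨fun j => μ (a.1 (ν⁻¹ j)), fun x y hxy =>
    (Equiv.injective ν⁻¹) (a.2 (Equiv.injective μ hxy))⟩

/-- `φ(μ,ν)` as a permutation of the vertices of `S_{n,k}`. -/
def phiPerm (n k : ℕ) (μ : Equiv.Perm (Fin n)) (ν : Equiv.Perm (Fin k)) :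
    Equiv.Perm (StarVertex n k) where
  toFun := phi n k μ ν
  invFun := phi n k μ⁻¹ ν⁻¹
  left_inv a := Subtype.ext (funext fun j => by simp [phi])
  right_inv a := Subtype.ext (funext fun j => by simp [phi])

/-- A subgroup `H ≤ S_n` is `m`-transitive: it acts transitively on the set of
`m`-permutations (injective `m`-tuples). -/
def IsMultTrans (n m : ℕ) (H : Subgroup (Equiv.Perm (Fin n))) : Prop :=
  ∀ a b : Fin m → Fin n, Function.Injective a → Function.Injective b →
    ∃ μ ∈ H, ∀ j, μ (a j) = b j

/-- A subgroup `H ≤ S_n` is sharply `m`-transitive: it acts regularly on the set of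
`m`-permutations (injective `m`-tuples). -/
def IsSharplyMultTrans (n m : ℕ) (H : Subgroup (Equiv.Perm (Fin n))) : Prop :=
  ∀ a b : Fin m → Fin n, Function.Injective a → Function.Injective b →
    ∃! μ : H, ∀ j, (μ : Equiv.Perm (Fin n)) (a j) = b j

namespace StarVertex

variable {n m : ℕ}

instance (n k : ℕ) : Finite (StarVertex n k) :=
  inferInstanceAs (Finite {a : Fin k → Fin n // Function.Injective a})

/-- Exchange the entries in the first position and in position `i`. -/
def starSwap (u : StarVertex n (m + 1)) (i : Fin (m + 1)) : StarVertex n (m + 1) :=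
  ⟨fun j => u.1 (swap 0 i j), u.2.comp (swap 0 i).injective⟩

/-- Replace the first entry by an unused value `x`. -/
def resid (u : StarVertex n (m + 1)) (x : Fin n) (hx : ∀ j, u.1 j ≠ x) :
    StarVertex n (m + 1) :=
  ⟨Function.update u.1 0 x, by
    intro a b hab
    by_cases ha : a = 0 <;> by_cases hb : b = 0
    · rw [ha, hb]
    · subst ha
      rw [Function.update_self, Function.update_of_ne hb] at hab
      exact absurd hab.symm (hx b)
    · subst hb
      rw [Function.update_self, Function.update_of_ne ha] at hab
      exact absurd hab (hx a)
    · rw [Function.update_of_ne ha, Function.update_of_ne hb] at hab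
      exact u.2 hab⟩

variable (u v w : StarVertex n (m + 1)) {i j : Fin (m + 1)}

@[ext] lemma ext {k : ℕ} {u v : StarVertex n k} (h : ∀ j, u.1 j = v.1 j) : u = v :=
  Subtype.ext (funext h)

@[simp] lemma starSwap_apply_zero : (u.starSwap i).1 0 = u.1 i := by simp [starSwap]

@[simp] lemma starSwap_apply_self : (u.starSwap i).1 i = u.1 0 := by simp [starSwap]

lemma starSwap_apply_of_ne (h0 : j ≠ 0) (hi : j ≠ i) : (u.starSwap i).1 j = u.1 j := by
  simp [starSwap, swap_apply_of_ne_of_ne h0 hi]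

@[simp] lemma starSwap_zero : u.starSwap 0 = u := by ext; simp [starSwap]

@[simp] lemma starSwap_starSwap : (u.starSwap i).starSwap i = u := by ext; simp [starSwap]

lemma starSwap_left_injective : Function.Injective u.starSwap := fun i j h => by
  have := congrArg (fun v : StarVertex n (m + 1) => v.1 0) h
  simpa [u.2.eq_iff] using this

variable {u} in
@[simp] lemma resid_apply_zero {x : Fin n} (hx : ∀ j, u.1 j ≠ x) : (u.resid x hx).1 0 = x := by
  simp [resid]

variable {u} in
lemma resid_apply_of_ne {x : Fin n} (hx : ∀ j, u.1 j ≠ x) (hj : j ≠ 0) :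
    (u.resid x hx).1 j = u.1 j := by
  simp [resid, hj]

lemma exists_unused (h : m + 1 < n) : ∃ x, ∀ j, u.1 j ≠ x := by
  by_contra! hc
  have := Fintype.card_le_of_surjective u.1 hc
  simp at this
  omega

variable {u v w}

lemma isResEdge_iff : IsResEdge u v ↔ u.1 0 ≠ v.1 0 ∧ ∀ j ≠ 0, u.1 j = v.1 j := by
  simp [IsResEdge]

lemma isStarEdge_iff : IsStarEdge u v ↔ ∃ i ≠ 0, v = u.starSwap i := by
  constructor
  · rintro ⟨i, hi, h0, h⟩
    refine ⟨i, by simpa using hi, ?_⟩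
    ext1 j
    by_cases hj : j = 0
    · subst hj; simpa using (h0 0 rfl).1
    by_cases hji : j = i
    · subst hji; simpa using (h0 0 rfl).2
    rw [starSwap_apply_of_ne _ hj hji, h j (by simpa using hj) hji]
  · rintro ⟨i, hi, rfl⟩
    refine ⟨i, by simpa using hi, fun j hj => ?_, fun j hj hji => ?_⟩
    · obtain rfl : j = 0 := Fin.ext hj
      simp
    · exact starSwap_apply_of_ne _ (by simpa using hj) hji

lemma isStarEdge_starSwap (hi : i ≠ 0) : IsStarEdge u (u.starSwap i) :=
  isStarEdge_iff.2 ⟨i, hi, rfl⟩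

lemma isResEdge_resid {x : Fin n} (hx : ∀ j, u.1 j ≠ x) : IsResEdge u (u.resid x hx) :=
  isResEdge_iff.2 ⟨by simpa using hx 0, fun _ hj => (resid_apply_of_ne hx hj).symm⟩

lemma _root_.IsResEdge.symm (h : IsResEdge u v) : IsResEdge v u := by
  rw [isResEdge_iff] at *
  exact ⟨h.1.symm, fun j hj => (h.2 j hj).symm⟩

lemma _root_.IsStarEdge.symm (h : IsStarEdge u v) : IsStarEdge v u := by
  obtain ⟨i, hi, rfl⟩ := isStarEdge_iff.1 h
  exact isStarEdge_iff.2 ⟨i, hi, by simp⟩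

lemma _root_.IsResEdge.apply_ne (h : IsResEdge u v) (j) : u.1 j ≠ v.1 0 := by
  rw [isResEdge_iff] at h
  by_cases hj : j = 0
  · subst hj; exact h.1
  · rw [h.2 j hj]; exact fun h => hj (v.2 h)

lemma _root_.IsResEdge.eq_resid (h : IsResEdge u v) : v = u.resid (v.1 0) h.apply_ne := by
  ext1 j
  by_cases hj : j = 0
  · subst hj; simp
  · rw [resid_apply_of_ne _ hj, (isResEdge_iff.1 h).2 j hj]

lemma starGraph_adj : (starGraph n (m + 1)).Adj u v ↔ IsStarEdge u v ∨ IsResEdge u v := by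
  rw [starGraph, SimpleGraph.fromRel_adj]
  constructor
  · rintro ⟨-, h | h | h⟩
    exacts [h, .inl h.symm, .inr h.symm]
  · refine fun h => ⟨?_, .inl h⟩
    rintro rfl
    rcases h with h | h
    · obtain ⟨i, hi, h⟩ := isStarEdge_iff.1 h
      exact hi (u.starSwap_left_injective (by rw [← h, starSwap_zero]))
    · exact (isResEdge_iff.1 h).1 rfl

/-- A star edge changes only one entry beyond the first. -/
lemma _root_.IsStarEdge.exists_forall_ne (h : IsStarEdge u v) :
    ∃ i, ∀ j ≠ 0, j ≠ i → u.1 j = v.1 j := by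
  obtain ⟨i, -, rfl⟩ := isStarEdge_iff.1 h
  exact ⟨i, fun j h0 hj => (starSwap_apply_of_ne _ h0 hj).symm⟩

lemma not_adj_of_isStarEdge (huv : IsStarEdge u v) (huw : (starGraph n (m + 1)).Adj u w) :
    ¬ (starGraph n (m + 1)).Adj w v := by
  obtain ⟨i, hi, rfl⟩ := isStarEdge_iff.1 huv
  intro hwv
  have hne : u.1 i ≠ u.1 0 := fun h => hi (u.2 h)
  rw [starGraph_adj] at huw hwv
  rcases huw with huw | huw
  · obtain ⟨j, hj, rfl⟩ := isStarEdge_iff.1 huw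
    by_cases hij : i = j
    · subst hij
      exact (starGraph n (m + 1)).irrefl (starGraph_adj.2 hwv)
    have hj' : u.1 j ≠ u.1 0 := fun h => hj (u.2 h)
    obtain ⟨s, hs⟩ : ∃ s, ∀ l ≠ 0, l ≠ s → (u.starSwap j).1 l = (u.starSwap i).1 l := by
      rcases hwv with hwv | hwv
      · exact hwv.exists_forall_ne
      · exact ⟨0, fun l hl _ => (isResEdge_iff.1 hwv).2 l hl⟩
    have h1 := hs i hi
    have h2 := hs j hj
    rw [starSwap_apply_self, starSwap_apply_of_ne _ hi hij] at h1
    rw [starSwap_apply_self, starSwap_apply_of_ne _ hj (Ne.symm hij)] at h2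
    have : i = s := by by_contra h; exact hne (h1 h)
    have : j = s := by by_contra h; exact hj' (h2 h).symm
    simp_all
  · have hwi : u.1 i = w.1 i := (isResEdge_iff.1 huw).2 i hi
    have hw0 := (isResEdge_iff.1 huw).1
    rcases hwv with hwv | hwv
    · obtain ⟨j, hj, h⟩ := isStarEdge_iff.1 hwv
      have h1 := congrArg (fun v : StarVertex n (m + 1) => v.1 i) h
      simp only [starSwap_apply_self] at h1
      by_cases hij : i = j
      · subst hij
        rw [starSwap_apply_self] at h1
        exact hw0 h1
      · rw [starSwap_apply_of_ne _ hi hij, ← hwi] at h1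
        exact hne h1.symm
    · have := (isResEdge_iff.1 hwv).2 i hi
      rw [starSwap_apply_self, ← hwi] at this
      exact hne this

lemma exists_common_adj_of_isResEdge (hn : m + 1 + 2 ≤ n) (h : IsResEdge u v) :
    ∃ w, (starGraph n (m + 1)).Adj u w ∧ (starGraph n (m + 1)).Adj w v := by
  obtain ⟨x, hx⟩ : ∃ x, x ∉ insert (v.1 0) (Finset.univ.image u.1) := by
    by_contra! hc
    have h1 := Finset.card_insert_le (v.1 0) (Finset.univ.image u.1)
    have h2 := Finset.card_image_le (s := Finset.univ) (f := u.1)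
    rw [Finset.eq_univ_of_forall hc] at h1
    simp at h1 h2
    omega
  simp only [Finset.mem_insert, Finset.mem_image, Finset.mem_univ, true_and, not_or,
    not_exists] at hx
  refine ⟨u.resid x hx.2, starGraph_adj.2 (.inr (isResEdge_resid _)),
    starGraph_adj.2 (.inr (isResEdge_iff.2 ⟨by simpa using hx.1, fun j hj => ?_⟩))⟩
  rw [resid_apply_of_ne _ hj, (isResEdge_iff.1 h).2 j hj]

section Automorphism

variable {σ : Perm (StarVertex n (m + 1))}

lemma isResEdge_of_mem_graphAut (hn : m + 1 + 2 ≤ n) (hσ : σ ∈ graphAut (starGraph n (m + 1)))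
    (h : IsResEdge u v) : IsResEdge (σ u) (σ v) := by
  obtain ⟨w, huw, hwv⟩ := exists_common_adj_of_isResEdge hn h
  rcases starGraph_adj.1 ((hσ u v).2 (starGraph_adj.2 (.inr h))) with h | h
  · exact absurd ((hσ w v).2 hwv) (not_adj_of_isStarEdge h ((hσ u w).2 huw))
  · exact h

lemma isStarEdge_of_mem_graphAut (hn : m + 1 + 2 ≤ n) (hσ : σ ∈ graphAut (starGraph n (m + 1)))
    (h : IsStarEdge u v) : IsStarEdge (σ u) (σ v) := by
  rcases starGraph_adj.1 ((hσ u v).2 (starGraph_adj.2 (.inl h))) with h' | h'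
  · exact h'
  · have := isResEdge_of_mem_graphAut hn (inv_mem hσ) h'
    rw [← Perm.mul_apply, ← Perm.mul_apply, inv_mul_cancel] at this
    obtain ⟨w, huw, hwv⟩ := exists_common_adj_of_isResEdge hn this
    exact absurd hwv (not_adj_of_isStarEdge h huw)

/-- `σ` fixes `u` and all its neighbours. -/
def FixesBall (σ : Perm (StarVertex n (m + 1))) (u : StarVertex n (m + 1)) : Prop :=
  σ u = u ∧ ∀ v, (starGraph n (m + 1)).Adj u v → σ v = v

lemma FixesBall.starSwap_eq (hu : FixesBall σ u) (hi : i ≠ 0) : σ (u.starSwap i) = u.starSwap i :=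
  hu.2 _ (starGraph_adj.2 (.inl (isStarEdge_starSwap hi)))

lemma FixesBall.resid_eq (hu : FixesBall σ u) {x : Fin n} (hx : ∀ j, u.1 j ≠ x) : σ (u.resid x hx) = u.resid x hx :=
  hu.2 _ (starGraph_adj.2 (.inr (isResEdge_resid hx)))

variable (hn : m + 1 + 2 ≤ n) (hσ : σ ∈ graphAut (starGraph n (m + 1))) (hu : FixesBall σ u)
include hn hσ hu

lemma FixesBall.resid_starSwap_eq {x : Fin n} (hx : ∀ j, u.1 j ≠ x) (hi : i ≠ 0) :
    σ ((u.resid x hx).starSwap i) = (u.resid x hx).starSwap i := by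
  have hS := isStarEdge_of_mem_graphAut hn hσ (isStarEdge_starSwap (u := u.resid x hx) hi)
  rw [hu.resid_eq] at hS
  obtain ⟨j, hj, h⟩ := isStarEdge_iff.1 hS
  by_cases hij : i = j
  · rw [h, hij]
  exfalso
  have hx' : ∀ l, (u.starSwap i).1 l ≠ x := fun l => hx _
  have h1 := isResEdge_of_mem_graphAut hn hσ (isResEdge_resid hx')
  have h2 := isStarEdge_of_mem_graphAut hn hσ
    (isStarEdge_starSwap (u := (u.starSwap i).resid x hx') hi)
  have h3 : IsResEdge (((u.starSwap i).resid x hx').starSwap i) ((u.resid x hx).starSwap i) := by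
    refine isResEdge_iff.2 ⟨?_, fun l hl => ?_⟩
    · simp [resid_apply_of_ne, hi, u.2.eq_iff, Ne.symm hi]
    · by_cases hli : l = i
      · subst hli; simp
      · simp [starSwap_apply_of_ne, resid_apply_of_ne, hl, hli]
  replace h3 := isResEdge_of_mem_graphAut hn hσ h3
  rw [hu.starSwap_eq hi] at h1
  rw [h] at h3
  obtain ⟨s, hs⟩ := h2.exists_forall_ne
  have key : ∀ l ≠ 0, l ≠ s → (u.starSwap i).1 l = ((u.resid x hx).starSwap j).1 l :=
    fun l hl hls => ((isResEdge_iff.1 h1).2 l hl).trans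
      ((hs l hl hls).trans ((isResEdge_iff.1 h3).2 l hl))
  have hi' : i = s := by
    by_contra hc
    have := key i hi hc
    rw [starSwap_apply_self, starSwap_apply_of_ne _ hi hij, resid_apply_of_ne _ hi] at this
    exact hi (u.2 this).symm
  have hj' : j = s := by
    by_contra hc
    have := key j hj hc
    rw [starSwap_apply_self, starSwap_apply_of_ne _ hj (Ne.symm hij), resid_apply_zero] at this
    exact hx _ this
  exact hij (hi'.trans hj'.symm)

lemma FixesBall.starSwap_isResEdge_eq (hi : i ≠ 0) (hw : IsResEdge (u.starSwap i) w) :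
    σ w = w := by
  have hR := isResEdge_of_mem_graphAut hn hσ hw
  rw [hu.starSwap_eq hi] at hR
  have hx : ∀ j, u.1 j ≠ w.1 0 := fun j => by
    have := hw.apply_ne (swap 0 i j)
    simpa [starSwap] using this
  have hwi : w.1 i = u.1 0 := by
    rw [← (isResEdge_iff.1 hw).2 i hi, starSwap_apply_self]
  have hswi : (σ w).1 i = u.1 0 := by
    rw [← (isResEdge_iff.1 hR).2 i hi, starSwap_apply_self]
  have h1 : IsResEdge ((u.resid _ hx).starSwap i) (w.starSwap i) := by
    refine isResEdge_iff.2 ⟨?_, fun l hl => ?_⟩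
    · simp [resid_apply_of_ne, hi, hwi, u.2.eq_iff]
    · by_cases hli : l = i
      · subst hli; simp
      · rw [starSwap_apply_of_ne _ hl hli, starSwap_apply_of_ne _ hl hli, resid_apply_of_ne _ hl,
          ← (isResEdge_iff.1 hw).2 l hl, starSwap_apply_of_ne _ hl hli]
  replace h1 := isResEdge_of_mem_graphAut hn hσ h1
  rw [hu.resid_starSwap_eq hn hσ hx hi] at h1
  have h2 := isStarEdge_of_mem_graphAut hn hσ (isStarEdge_starSwap (u := w) hi).symm
  have h1i := (isResEdge_iff.1 h1).2 i hi
  rw [starSwap_apply_self, resid_apply_zero] at h1i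
  obtain ⟨s, hs, h⟩ := isStarEdge_iff.1 h2
  have his : i = s := by
    by_contra his
    rw [h, starSwap_apply_of_ne _ hi his, ← h1i] at hswi
    exact hx 0 hswi.symm
  ext1 l
  by_cases hl : l = 0
  · subst hl
    rw [h, starSwap_apply_zero, ← his, ← h1i]
  · rw [← (isResEdge_iff.1 hR).2 l hl, (isResEdge_iff.1 hw).2 l hl]

lemma FixesBall.starSwap_starSwap_eq (hi : i ≠ 0) (hj : j ≠ 0) :
    σ ((u.starSwap i).starSwap j) = (u.starSwap i).starSwap j := by
  by_cases hij : i = j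
  · subst hij
    simpa using hu.1
  have hS := isStarEdge_of_mem_graphAut hn hσ (isStarEdge_starSwap (u := u.starSwap i) hj)
  rw [hu.starSwap_eq hi] at hS
  obtain ⟨l, hl, h⟩ := isStarEdge_iff.1 hS
  by_cases hlj : l = j
  · rw [h, hlj]
  exfalso
  by_cases hli : l = i
  · rw [hli, starSwap_starSwap] at h
    have := σ.injective (h.trans hu.1.symm)
    have := congrArg (fun v : StarVertex n (m + 1) => v.1 0) this
    simp only [starSwap_apply_zero, starSwap_apply_of_ne _ hj (Ne.symm hij)] at this
    exact hj (u.2 this)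
  obtain ⟨x, hx⟩ := u.exists_unused (by omega)
  have hx' : ∀ l, (u.starSwap j).1 l ≠ x := fun l => hx _
  set p := ((u.starSwap j).resid x hx').starSwap j with hp
  have h1 : IsResEdge ((u.resid x hx).starSwap j) p := by
    refine isResEdge_iff.2 ⟨?_, fun l hl => ?_⟩
    · simp [hp, resid_apply_of_ne, hj, u.2.eq_iff]
    · by_cases hlj : l = j
      · subst hlj; simp [hp]
      · simp [hp, starSwap_apply_of_ne, resid_apply_of_ne, hl, hlj]
  have hji := Ne.symm hij
  have h4 : IsResEdge ((p.starSwap i).starSwap j) ((u.starSwap i).starSwap j) := by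
    refine isResEdge_iff.2 ⟨?_, fun l hl => ?_⟩
    · simpa [hp, starSwap_apply_of_ne, resid_apply_of_ne, hj, hij, hji] using (hx j).symm
    · by_cases hlj : l = j
      · subst hlj; simp [hp, starSwap_apply_of_ne, resid_apply_of_ne, hi, hij]
      · by_cases hli : l = i
        · subst hli; simp [hp, starSwap_apply_of_ne, resid_apply_of_ne, hl, hlj, hj]
        · simp [hp, starSwap_apply_of_ne, resid_apply_of_ne, hl, hlj, hli]
  replace h1 := isResEdge_of_mem_graphAut hn hσ h1
  replace h4 := isResEdge_of_mem_graphAut hn hσ h4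
  rw [hu.resid_starSwap_eq hn hσ hx hj] at h1
  rw [h] at h4
  obtain ⟨s, hs⟩ := (isStarEdge_of_mem_graphAut hn hσ
    (isStarEdge_starSwap (u := p) hi)).exists_forall_ne
  obtain ⟨t, ht⟩ := (isStarEdge_of_mem_graphAut hn hσ
    (isStarEdge_starSwap (u := p.starSwap i) hj)).exists_forall_ne
  have key : ∀ a ≠ 0, ((u.resid x hx).starSwap j).1 a ≠ ((u.starSwap i).starSwap l).1 a →
      a = s ∨ a = t := by
    intro a ha hne
    by_contra! hc
    exact hne (((isResEdge_iff.1 h1).2 a ha).trans ((hs a ha hc.1).trans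
      ((ht a ha hc.2).trans ((isResEdge_iff.1 h4).2 a ha))))
  have k1 := key i hi (by
    simp [starSwap_apply_of_ne, resid_apply_of_ne, hi, hij, Ne.symm hli, u.2.eq_iff])
  have k2 := key j hj (by
    simpa [starSwap_apply_of_ne, hj, hji, Ne.symm hlj] using (hx j).symm)
  have k3 := key l hl (by
    simp [starSwap_apply_of_ne, resid_apply_of_ne, hl, hlj, hli, u.2.eq_iff])
  grind

lemma FixesBall.of_adj (hv : (starGraph n (m + 1)).Adj u v) : FixesBall σ v := by
  refine ⟨hu.2 v hv, fun w hw => ?_⟩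
  rw [starGraph_adj] at hv hw
  rcases hv with hv | hv
  · obtain ⟨i, hi, rfl⟩ := isStarEdge_iff.1 hv
    rcases hw with hw | hw
    · obtain ⟨j, hj, rfl⟩ := isStarEdge_iff.1 hw
      exact hu.starSwap_starSwap_eq hn hσ hi hj
    · exact hu.starSwap_isResEdge_eq hn hσ hi hw
  · rcases hw with hw | hw
    · obtain ⟨j, hj, rfl⟩ := isStarEdge_iff.1 hw
      rw [hv.eq_resid]
      exact hu.resid_starSwap_eq hn hσ _ hj
    · by_cases h0 : u.1 0 = w.1 0
      · have : w = u := by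
          ext1 l
          by_cases hl : l = 0
          · rw [hl, h0]
          · rw [(isResEdge_iff.1 hv).2 l hl, (isResEdge_iff.1 hw).2 l hl]
        rw [this, hu.1]
      · exact hu.2 w (starGraph_adj.2 (.inr (isResEdge_iff.2 ⟨h0, fun l hl =>
          ((isResEdge_iff.1 hv).2 l hl).trans ((isResEdge_iff.1 hw).2 l hl)⟩)))

end Automorphism

section Connected

variable {P : StarVertex n (m + 1) → Prop}
  (hP : ∀ u v, P u → (starGraph n (m + 1)).Adj u v → P v)
include hP

lemma exists_update (hu : P u) (i : Fin (m + 1)) {x : Fin n} (hx : ∀ j, u.1 j ≠ x) :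
    ∃ v, P v ∧ v.1 i = x ∧ ∀ j ≠ i, v.1 j = u.1 j := by
  have hS : ∀ u, P u → ∀ i, P (u.starSwap i) := fun u hu i => by
    by_cases hi : i = 0
    · simpa [hi] using hu
    · exact hP _ _ hu (starGraph_adj.2 (.inl (isStarEdge_starSwap hi)))
  have hx' : ∀ l, (u.starSwap i).1 l ≠ x := fun l => hx _
  refine ⟨((u.starSwap i).resid x hx').starSwap i, hS _ (hP _ _ (hS u hu i)
    (starGraph_adj.2 (.inr (isResEdge_resid hx')))) i, by simp, fun j hj => ?_⟩
  by_cases hj0 : j = 0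
  · subst hj0
    simp [resid_apply_of_ne, Ne.symm hj]
  · simp [starSwap_apply_of_ne, resid_apply_of_ne, hj0, hj]

lemma forall_of_adj_closed (hn : m + 1 + 2 ≤ n) (hu : P u) : P v := by
  suffices H : ∀ s : Finset (Fin (m + 1)), ∃ w, P w ∧ ∀ j ∈ s, w.1 j = v.1 j by
    obtain ⟨w, hw, h⟩ := H Finset.univ
    rwa [show v = w from ext fun j => (h j (Finset.mem_univ j)).symm]
  intro s
  induction s using Finset.induction with
  | empty => exact ⟨u, hu, by simp⟩
  | insert i s hi ih =>
    obtain ⟨w, hw, h⟩ := ih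
    obtain ⟨w, hw, h, hwi⟩ : ∃ w, P w ∧ (∀ j ∈ s, w.1 j = v.1 j) ∧
        ((∀ j, w.1 j ≠ v.1 i) ∨ w.1 i = v.1 i) := by
      by_cases hc : ∀ j, w.1 j ≠ v.1 i
      · exact ⟨w, hw, h, .inl hc⟩
      push Not at hc
      obtain ⟨l, hl⟩ := hc
      by_cases hli : l = i
      · exact ⟨w, hw, h, .inr (hli ▸ hl)⟩
      have hls : l ∉ s := fun hls => hli (v.2 ((h l hls).symm.trans hl))
      obtain ⟨x, hx⟩ := w.exists_unused (by omega)
      obtain ⟨w', hw', hl', h'⟩ := exists_update hP hw l hx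
      refine ⟨w', hw', fun j hj => ?_, .inl fun j hj => ?_⟩
      · rw [h' j (by rintro rfl; exact hls hj), h j hj]
      · by_cases hjl : j = l
        · rw [hjl, hl', ← hl] at hj
          exact hx l hj.symm
        · rw [h' j hjl, ← hl] at hj
          exact hjl (w.2 hj)
    rcases hwi with hwi | hwi
    · obtain ⟨w', hw', hi', h'⟩ := exists_update hP hw i hwi
      refine ⟨w', hw', fun j hj => ?_⟩
      rcases Finset.mem_insert.1 hj with rfl | hjs
      · exact hi'
      · rw [h' j (by rintro rfl; exact hi hjs), h j hjs]
    · refine ⟨w, hw, fun j hj => ?_⟩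
      rcases Finset.mem_insert.1 hj with rfl | hj
      exacts [hwi, h j hj]

end Connected

lemma FixesBall.eq_one (hn : m + 1 + 2 ≤ n) {σ : Perm (StarVertex n (m + 1))}
    (hσ : σ ∈ graphAut (starGraph n (m + 1))) (hu : FixesBall σ u) : σ = 1 :=
  Equiv.ext fun _ =>
    (forall_of_adj_closed (P := FixesBall σ) (fun _ _ h => h.of_adj hn hσ) hn hu).1

/-- The action of `S_n × S_{k-1}` on the vertices. -/
def phiHom (n k : ℕ) : Perm (Fin n) × SkSub k →* Perm (StarVertex n k) where
  toFun g := phiPerm n k g.1 g.2.1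
  map_one' := rfl
  map_mul' _ _ := rfl

lemma phiHom_apply {k : ℕ} (g : Perm (Fin n) × SkSub k) (a : StarVertex n k) :
    phiHom n k g a = phi n k g.1 g.2.1 a := rfl

lemma SkSub_zero (ν : SkSub (m + 1)) : ν.1 0 = 0 := ν.2 0 rfl

lemma phiHom_starSwap (g : Perm (Fin n) × SkSub (m + 1)) :
    phiHom n (m + 1) g (u.starSwap i) = (phiHom n (m + 1) g u).starSwap (g.2.1 i) := by
  have h : swap 0 (g.2.1 i) = g.2.1 * swap 0 i * (g.2.1)⁻¹ := by
    rw [← swap_apply_apply, SkSub_zero]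
  refine ext fun j => ?_
  change g.1 (u.1 (swap 0 i ((g.2.1)⁻¹ j))) = g.1 (u.1 ((g.2.1)⁻¹ (swap 0 (g.2.1 i) j)))
  rw [h]
  simp

lemma phiHom_isResEdge (g : Perm (Fin n) × SkSub (m + 1)) (h : IsResEdge u v) :
    IsResEdge (phiHom n (m + 1) g u) (phiHom n (m + 1) g v) := by
  have h0 : (g.2.1)⁻¹ 0 = 0 := SkSub_zero g.2⁻¹
  rw [isResEdge_iff] at *
  refine ⟨by simpa only [phiHom_apply, phi, h0, ne_eq, g.1.injective.eq_iff] using h.1, fun j hj => ?_⟩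
  have : (g.2.1)⁻¹ j ≠ 0 := fun h => hj (by rw [Perm.inv_eq_iff_eq.1 h, SkSub_zero])
  simp only [phiHom_apply, phi, h.2 _ this]

lemma phiHom_adj_of_adj (g : Perm (Fin n) × SkSub (m + 1))
    (h : (starGraph n (m + 1)).Adj u v) :
    (starGraph n (m + 1)).Adj (phiHom n (m + 1) g u) (phiHom n (m + 1) g v) := by
  rw [starGraph_adj] at *
  refine h.imp (fun h => ?_) (phiHom_isResEdge g)
  obtain ⟨i, hi, rfl⟩ := isStarEdge_iff.1 h
  refine isStarEdge_iff.2 ⟨g.2.1 i, fun h => hi (g.2.1.injective ?_), phiHom_starSwap g⟩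
  rw [h, SkSub_zero]

lemma phiHom_mem_graphAut (g : Perm (Fin n) × SkSub (m + 1)) :
    phiHom n (m + 1) g ∈ graphAut (starGraph n (m + 1)) := fun u v =>
  ⟨fun h => by simpa [map_inv] using phiHom_adj_of_adj g⁻¹ h, phiHom_adj_of_adj g⟩

lemma phiHom_injective (hn : m + 1 + 2 ≤ n) : Function.Injective (phiHom n (m + 1)) := by
  refine (injective_iff_map_eq_one _).2 fun g hg => ?_
  have h : ∀ (a : StarVertex n (m + 1)) j, g.1 (a.1 ((g.2.1)⁻¹ j)) = a.1 j := fun a j => by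
    have : phiHom n (m + 1) g a = a := by rw [hg, Perm.one_apply]
    exact congrArg (fun v : StarVertex n (m + 1) => v.1 j) this
  let e := eVert n (m + 1) (by omega)
  obtain ⟨x, hx⟩ := e.exists_unused (by omega)
  have hν : ∀ j, (g.2.1)⁻¹ j = j := by
    intro j
    by_contra hj
    obtain ⟨v, -, hvj, hv⟩ :=
      exists_update (P := fun _ => True) (fun _ _ _ _ => trivial) (u := e) trivial j hx
    have h1 := h v j
    rw [hv _ hj, h e j, hvj] at h1
    exact hx j h1
  refine Prod.ext (Equiv.ext fun y => ?_) (Subtype.ext (Equiv.ext fun j => ?_))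
  · by_cases hy : ∀ j, e.1 j ≠ y
    · simpa [hν] using h (e.resid y hy) 0
    · push Not at hy
      obtain ⟨j, rfl⟩ := hy
      simpa only [hν, Prod.fst_one, Perm.one_apply] using h e j
  · exact (Perm.inv_eq_iff_eq.1 (hν j)).symm

lemma exists_phiHom_eq (hn : m + 1 + 2 ≤ n) {σ : Perm (StarVertex n (m + 1))}
    (hσ : σ ∈ graphAut (starGraph n (m + 1))) : ∃ g, phiHom n (m + 1) g = σ := by
  let e := eVert n (m + 1) (by omega)
  have hS : ∀ i, ∃ j, σ (e.starSwap i) = (σ e).starSwap j ∧ (i = 0 → j = 0) := fun i => by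
    by_cases hi : i = 0
    · exact ⟨0, by simp [hi], fun _ => rfl⟩
    · obtain ⟨j, -, h⟩ := isStarEdge_iff.1
        (isStarEdge_of_mem_graphAut hn hσ (isStarEdge_starSwap (u := e) hi))
      exact ⟨j, h, fun h => absurd h hi⟩
  choose f hf hf0 using hS
  have hfi : Function.Injective f := fun i j hij =>
    e.starSwap_left_injective (σ.injective (by rw [hf, hf, hij]))
  let ν : Perm (Fin (m + 1)) := Equiv.ofBijective f (Finite.injective_iff_bijective.1 hfi)
  have hR : ∀ x (hx : ∀ j, e.1 j ≠ x), IsResEdge (σ e) (σ (e.resid x hx)) := fun x hx =>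
    isResEdge_of_mem_graphAut hn hσ (isResEdge_resid hx)
  have hM : ∀ y, ∃ z, (∀ i, e.1 i = y → z = (σ e).1 (f i)) ∧
      ∀ hy, z = (σ (e.resid y hy)).1 0 := fun y => by
    by_cases hy : ∀ j, e.1 j ≠ y
    · exact ⟨(σ (e.resid y hy)).1 0, fun i hi => absurd hi (hy i), fun _ => rfl⟩
    · have ⟨i, hi⟩ := not_forall_not.1 hy
      exact ⟨(σ e).1 (f i), fun j hj => by rw [e.2 (hi.trans hj.symm)], fun h => absurd h hy⟩
  choose M hM1 hM2 using hM
  have hMi : Function.Injective M := by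
    intro y z hyz
    by_cases hy : ∀ j, e.1 j ≠ y <;> by_cases hz : ∀ j, e.1 j ≠ z
    · rw [hM2 y hy, hM2 z hz] at hyz
      have : σ (e.resid y hy) = σ (e.resid z hz) := by
        rw [(hR y hy).eq_resid, (hR z hz).eq_resid]
        simp only [hyz]
      simpa using congrArg (fun v : StarVertex n (m + 1) => v.1 0) (σ.injective this)
    · obtain ⟨i, hi⟩ := not_forall_not.1 hz
      rw [hM2 y hy, hM1 z i hi] at hyz
      exact absurd hyz.symm ((hR y hy).apply_ne _)
    · obtain ⟨i, hi⟩ := not_forall_not.1 hy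
      rw [hM1 y i hi, hM2 z hz] at hyz
      exact absurd hyz ((hR z hz).apply_ne _)
    · obtain ⟨i, hi⟩ := not_forall_not.1 hy
      obtain ⟨j, hj⟩ := not_forall_not.1 hz
      rw [hM1 y i hi, hM1 z j hj] at hyz
      rw [← hi, ← hj, hfi ((σ e).2 hyz)]
  let μ : Perm (Fin n) := Equiv.ofBijective M (Finite.injective_iff_bijective.1 hMi)
  have hν0 : ν ∈ SkSub (m + 1) := fun j hj => by
    obtain rfl : j = 0 := Fin.ext hj
    exact hf0 0 rfl
  let g : Perm (Fin n) × SkSub (m + 1) := (μ, ⟨ν, hν0⟩)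
  have hν (j) : f (ν⁻¹ j) = j := Equiv.apply_symm_apply ν j
  have hge : phiHom n (m + 1) g e = σ e := ext fun j =>
    (hM1 _ (ν⁻¹ j) rfl).trans (by rw [hν])
  have hgS (i) : phiHom n (m + 1) g (e.starSwap i) = σ (e.starSwap i) := by
    rw [phiHom_starSwap, hge, hf]
    rfl
  have hgR (x hx) : phiHom n (m + 1) g (e.resid x hx) = σ (e.resid x hx) := by
    have h1 := phiHom_isResEdge g (isResEdge_resid hx)
    rw [hge] at h1
    have h0 : (phiHom n (m + 1) g (e.resid x hx)).1 0 = (σ (e.resid x hx)).1 0 := by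
      have : ν⁻¹ 0 = 0 := SkSub_zero g.2⁻¹
      rw [← hM2 x hx]
      change M ((e.resid x hx).1 (ν⁻¹ 0)) = M x
      rw [this, resid_apply_zero]
    rw [h1.eq_resid, (hR x hx).eq_resid]
    simp only [h0]
  refine ⟨g, ?_⟩
  have hinv {v} (h : phiHom n (m + 1) g v = σ v) : ((phiHom n (m + 1) g)⁻¹ * σ) v = v := by
    rw [Perm.mul_apply, ← h, ← Perm.mul_apply, inv_mul_cancel, Perm.one_apply]
  have hball : FixesBall ((phiHom n (m + 1) g)⁻¹ * σ) e := by
    refine ⟨hinv hge, fun v hv => hinv ?_⟩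
    rcases starGraph_adj.1 hv with hv | hv
    · obtain ⟨i, -, rfl⟩ := isStarEdge_iff.1 hv
      exact hgS i
    · rw [hv.eq_resid]
      exact hgR _ _
  exact inv_mul_eq_one.1 (hball.eq_one hn (mul_mem (inv_mem (phiHom_mem_graphAut g)) hσ))

lemma card_eq {k : ℕ} (h : k ≤ n) :
    Nat.card (StarVertex n k) = n.factorial / (n - k).factorial := by
  have e : StarVertex n k ≃ (Fin k ↪ Fin n) := Equiv.subtypeInjectiveEquivEmbedding _ _
  rw [Nat.card_congr e, Nat.card_eq_fintype_card, Fintype.card_embedding_eq, Fintype.card_fin,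
    Fintype.card_fin, Nat.descFactorial_eq_div h]

end StarVertex

lemma SimpleGraph.fromRel_inv_mul_adj {G : Type*} [Group G] {S : Set G} (h1 : (1 : G) ∉ S)
    (hS : ∀ s ∈ S, s⁻¹ ∈ S) {g h : G} :
    (SimpleGraph.fromRel fun g h : G => g⁻¹ * h ∈ S).Adj g h ↔ g⁻¹ * h ∈ S := by
  rw [SimpleGraph.fromRel_adj]
  refine ⟨?_, fun h => ⟨?_, .inl h⟩⟩
  · rintro ⟨-, h | h⟩
    exacts [h, by simpa using hS _ h]
  · rintro rfl
    exact h1 (by simpa using h)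

/-- The vertices of a graph which is isomorphic to a Cayley graph carry a regular group action by
graph automorphisms. -/
lemma IsCayleyGraph.exists_regular {V : Type*} {Γ : SimpleGraph V} (h : IsCayleyGraph Γ) :
    ∃ R : Subgroup (Perm V), R ≤ graphAut Γ ∧
      ∀ v, Function.Bijective fun σ : R => (σ : Perm V) v := by
  obtain ⟨G, _, _, S, h1, hS, ⟨f⟩⟩ := h
  let Λ : G →* Perm V := f.toEquiv.symm.permCongrHom.toMonoidHom.comp (MulAction.toPermHom G G)
  have hΛ (g v) : Λ g v = f.symm (g * f v) := rfl
  refine ⟨Λ.range, ?_, fun v => ⟨?_, fun w => ?_⟩⟩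
  · rintro _ ⟨g, rfl⟩ u w
    rw [hΛ, hΛ, f.symm.map_adj_iff, SimpleGraph.fromRel_inv_mul_adj h1 hS, ← f.map_adj_iff,
      SimpleGraph.fromRel_inv_mul_adj h1 hS]
    simp [mul_assoc]
  · rintro ⟨_, g, rfl⟩ ⟨_, h, rfl⟩ hgh
    have : g = h := by simpa [hΛ] using hgh
    exact Subtype.ext (congrArg Λ this)
  · exact ⟨⟨_, f w * (f v)⁻¹, rfl⟩, (hΛ _ _).trans (by simp)⟩

/-- A graph with a regular action of a finite group by automorphisms is a Cayley graph. -/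
lemma IsCayleyGraph.of_bijective {V G : Type} [Group G] [Finite G] {Γ : SimpleGraph V}
    (Φ : G →* Perm V) (hΦ : ∀ g, Φ g ∈ graphAut Γ) (e : V)
    (h : Function.Bijective fun g => Φ g e) : IsCayleyGraph Γ := by
  have : Fintype G := Fintype.ofFinite G
  have h1 : (1 : G) ∉ {g | Γ.Adj e (Φ g e)} := by simp
  have hS : ∀ s ∈ {g | Γ.Adj e (Φ g e)}, s⁻¹ ∈ {g | Γ.Adj e (Φ g e)} := fun s hs => by
    have := (hΦ s⁻¹ _ _).2 hs
    rw [← Perm.mul_apply, ← map_mul, inv_mul_cancel, map_one] at this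
    exact this.symm
  refine ⟨G, _, this, {g | Γ.Adj e (Φ g e)}, h1, hS,
    ⟨RelIso.symm ⟨Equiv.ofBijective _ h, fun {g k} => ?_⟩⟩⟩
  rw [SimpleGraph.fromRel_inv_mul_adj h1 hS, Set.mem_ofPred_eq, ← hΦ g e, ← Perm.mul_apply (Φ g),
    ← map_mul, mul_inv_cancel_left]
  rfl

/-- For `k ≥ 2` and `n ≥ k+2` the following are equivalent: (i) `S_{n,k}` is a Cayley graph;
(ii) there is a subgroup `G ≤ S_n × S_{k-1}` such that `(μ,ν) ↦ overline{μν⁻¹}` is a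
bijection `G → V(S_{n,k})`; (iii) there is a subgroup `G ≤ S_n × S_{k-1}` of order
`n!/(n-k)!` whose stabilizer of the vertex `ē = [1,…,k]` (under the action `φ`) is
trivial. -/
theorem star_graph_cayley_tfae (n k : ℕ) (hk : 2 ≤ k) (hn : k + 2 ≤ n) :
    List.TFAE [
      IsCayleyGraph (starGraph n k),
      ∃ G : Subgroup (Equiv.Perm (Fin n) × ↥(SkSub k)),
        Function.Bijective fun g : ↥G => phi n k g.1.1 g.1.2.1 (eVert n k (by omega)),
      ∃ G : Subgroup (Equiv.Perm (Fin n) × ↥(SkSub k)),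
        Nat.card ↥G = Nat.factorial n / Nat.factorial (n - k) ∧
        ∀ g : ↥G, phi n k g.1.1 g.1.2.1 (eVert n k (by omega)) = eVert n k (by omega) →
          g = 1] := by
  obtain ⟨m, rfl⟩ : ∃ m, k = m + 1 := ⟨k - 1, by omega⟩
  set e := eVert n (m + 1) (by omega)
  tfae_have 1 → 2 := by
    intro h
    obtain ⟨R, hR, hreg⟩ := h.exists_regular
    refine ⟨R.comap (StarVertex.phiHom n (m + 1)), fun a b hab => ?_, fun v => ?_⟩
    · have : (⟨_, a.2⟩ : R) = ⟨_, b.2⟩ := (hreg e).1 hab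
      exact Subtype.ext (StarVertex.phiHom_injective hn (congrArg Subtype.val this))
    · obtain ⟨⟨σ, hσ⟩, rfl⟩ := (hreg e).2 v
      obtain ⟨g, rfl⟩ := StarVertex.exists_phiHom_eq hn (hR hσ)
      exact ⟨⟨g, hσ⟩, rfl⟩
  tfae_have 2 → 1 := by
    rintro ⟨G, hG⟩
    exact IsCayleyGraph.of_bijective ((StarVertex.phiHom n (m + 1)).comp G.subtype)
      (fun g => StarVertex.phiHom_mem_graphAut g.1) e hG
  tfae_have 2 → 3 := by
    rintro ⟨G, hG⟩
    refine ⟨G, by rw [Nat.card_eq_of_bijective _ hG, StarVertex.card_eq (by omega)],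
      fun g hg => hG.1 (hg.trans ?_)⟩
    exact (congrArg (· e) (map_one (StarVertex.phiHom n (m + 1)))).symm
  tfae_have 3 → 2 := by
    rintro ⟨G, hcard, hG⟩
    refine ⟨G, (Nat.bijective_iff_injective_and_card _).2 ⟨fun a b hab => ?_, ?_⟩⟩
    · refine (inv_mul_eq_one.1 (hG (a⁻¹ * b) ?_))
      change StarVertex.phiHom n (m + 1) (a.1⁻¹ * b.1) e = e
      have hab' : StarVertex.phiHom n (m + 1) a.1 e = StarVertex.phiHom n (m + 1) b.1 e := hab
      rw [map_mul, Perm.mul_apply, ← hab', ← Perm.mul_apply, ← map_mul, inv_mul_cancel, map_one,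
        Perm.one_apply]
    · rw [hcard, StarVertex.card_eq (by omega)]
  tfae_finish
end

section
/- For integers k ≥ 2 and n ≥ k+2, the map sending (μ,ν) ∈ S_n × S_{k−1} to φ(μ,ν) is an injective group homomorphism from S_n × S_{k−1} into the automorphism group of the graph S_{n,k}. As a consequence, the graph S_{n,k} is vertex-transitive. -/
open Equiv

theorem val_eq_zero_of_mem_SkSub {k : ℕ} {ν : Equiv.Perm (Fin k)} (hν : ν ∈ SkSub k)
    {j : Fin k} (h : (ν j).1 = 0) : j.1 = 0 := by
  rwa [ν.injective (hν _ h)] at h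

theorem IsResEdge.phi {n k : ℕ} (μ : Equiv.Perm (Fin n)) {ν : Equiv.Perm (Fin k)}
    (hν : ν ∈ SkSub k) {u v : StarVertex n k} (h : IsResEdge u v) :
    IsResEdge (phi n k μ ν u) (phi n k μ ν v) := by
  have hν' := (SkSub k).inv_mem hν
  refine ⟨fun j hj => ?_, fun j hj => ?_⟩
  · simpa only [_root_.phi, hν' j hj, ne_eq, EmbeddingLike.apply_eq_iff_eq] using h.1 j hj
  · exact congrArg μ (h.2 _ (hj ∘ val_eq_zero_of_mem_SkSub hν'))

theorem IsStarEdge.phi {n k : ℕ} (μ : Equiv.Perm (Fin n)) {ν : Equiv.Perm (Fin k)}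
    (hν : ν ∈ SkSub k) {u v : StarVertex n k} (h : IsStarEdge u v) :
    IsStarEdge (phi n k μ ν u) (phi n k μ ν v) := by
  have hν' := (SkSub k).inv_mem hν
  obtain ⟨i, hi, hswap, hfix⟩ := h
  have hi' : ν⁻¹ (ν i) = i := ν.symm_apply_apply i
  refine ⟨ν i, hi ∘ val_eq_zero_of_mem_SkSub hν, fun j hj => ?_, fun j hj hji => ?_⟩
  · simpa only [_root_.phi, hν' j hj, hi', EmbeddingLike.apply_eq_iff_eq] using hswap j hj
  · exact congrArg μ (hfix _ (hj ∘ val_eq_zero_of_mem_SkSub hν')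
      fun h0 => hji (ν.symm_apply_eq.mp h0))

theorem starGraph_adj_phiPerm {n k : ℕ} (μ : Equiv.Perm (Fin n)) {ν : Equiv.Perm (Fin k)}
    (hν : ν ∈ SkSub k) {u v : StarVertex n k} (h : (starGraph n k).Adj u v) :
    (starGraph n k).Adj (phiPerm n k μ ν u) (phiPerm n k μ ν v) := by
  rw [starGraph, SimpleGraph.fromRel_adj] at h ⊢
  exact ⟨(phiPerm n k μ ν).injective.ne h.1,
    h.2.imp (Or.imp (·.phi μ hν) (·.phi μ hν)) (Or.imp (·.phi μ hν) (·.phi μ hν))⟩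

theorem phiPerm_mem_graphAut {n k : ℕ} (μ : Equiv.Perm (Fin n)) {ν : Equiv.Perm (Fin k)}
    (hν : ν ∈ SkSub k) : phiPerm n k μ ν ∈ graphAut (starGraph n k) := by
  refine fun u w => ⟨fun h => ?_, starGraph_adj_phiPerm μ hν⟩
  have hinv : ∀ x, phiPerm n k μ⁻¹ ν⁻¹ (phiPerm n k μ ν x) = x := (phiPerm n k μ ν).left_inv
  simpa only [hinv] using starGraph_adj_phiPerm μ⁻¹ ((SkSub k).inv_mem hν) h

theorem phiPerm_mul (n k : ℕ) (μ μ' : Equiv.Perm (Fin n)) (ν ν' : Equiv.Perm (Fin k)) :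
    phiPerm n k (μ * μ') (ν * ν') = phiPerm n k μ ν * phiPerm n k μ' ν' :=
  Equiv.ext fun _ => Subtype.ext <| funext fun _ => rfl

theorem exists_phiPerm_one_apply_eq {n k : ℕ} (u w : StarVertex n k) :
    ∃ μ : Equiv.Perm (Fin n), phiPerm n k μ 1 u = w := by
  classical
  let e := (Equiv.ofInjective u.1 u.2).symm.trans (Equiv.ofInjective w.1 w.2)
  refine ⟨e.extendSubtype, Subtype.ext <| funext fun j => ?_⟩
  have h := e.extendSubtype_apply_of_mem (u.1 j) ⟨j, rfl⟩
  simpa [phiPerm, phi, e] using h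

theorem exists_starVertex_apply_eq {n k : ℕ} (h : k ≤ n) (j : Fin k) (x : Fin n) :
    ∃ a : StarVertex n k, a.1 j = x :=
  ⟨phi n k (Equiv.swap ((eVert n k h).1 j) x) 1 (eVert n k h), by simp [phi]⟩

theorem phiPerm_injective {n k : ℕ} (hk : 0 < k) (hkn : k ≤ n) :
    Function.Injective
      (fun p : Equiv.Perm (Fin n) × ↥(SkSub k) => phiPerm n k p.1 p.2.1) := by
  rintro ⟨μ, ν, hν⟩ ⟨μ', ν', hν'⟩ h
  have happ (a : StarVertex n k) (j : Fin k) : μ (a.1 (ν⁻¹ j)) = μ' (a.1 (ν'⁻¹ j)) :=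
    congrFun (congrArg Subtype.val (Equiv.congr_fun h a)) j
  obtain rfl : μ = μ' := by
    ext1 x
    obtain ⟨a, rfl⟩ := exists_starVertex_apply_eq hkn ⟨0, hk⟩ x
    have hfix : ν⁻¹ ⟨0, hk⟩ = ⟨0, hk⟩ := (SkSub k).inv_mem hν _ rfl
    have hfix' : ν'⁻¹ ⟨0, hk⟩ = ⟨0, hk⟩ := (SkSub k).inv_mem hν' _ rfl
    simpa only [hfix, hfix'] using happ a ⟨0, hk⟩
  obtain rfl : ν = ν' :=
    inv_injective <| Equiv.ext fun j =>
      (eVert n k hkn).2 (μ.injective (happ (eVert n k hkn) j))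
  rfl

/-- The map `(μ,ν) ↦ φ(μ,ν)` is an injective group homomorphism from `S_n × S_{k-1}` into
the automorphism group of `S_{n,k}`; as a consequence, `S_{n,k}` is vertex-transitive. -/
theorem phi_injective_hom (n k : ℕ) (hk : 2 ≤ k) (hn : k + 2 ≤ n) :
    (∀ (μ : Equiv.Perm (Fin n)) (ν : ↥(SkSub k)),
      phiPerm n k μ ν.1 ∈ graphAut (starGraph n k)) ∧
    (∀ (μ μ' : Equiv.Perm (Fin n)) (ν ν' : ↥(SkSub k)),
      phiPerm n k (μ * μ') (ν * ν').1 = phiPerm n k μ ν.1 * phiPerm n k μ' ν'.1) ∧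
    Function.Injective
      (fun p : Equiv.Perm (Fin n) × ↥(SkSub k) => phiPerm n k p.1 p.2.1) ∧
    ∀ u w : StarVertex n k, ∃ σ ∈ graphAut (starGraph n k), σ u = w := by
  refine ⟨fun μ ν => phiPerm_mem_graphAut μ ν.2,
    fun μ μ' ν ν' => phiPerm_mul n k μ μ' ν.1 ν'.1,
    phiPerm_injective (by omega) (by omega), fun u w => ?_⟩
  obtain ⟨μ, hμ⟩ := exists_phiPerm_one_apply_eq u w
  exact ⟨_, phiPerm_mem_graphAut μ (SkSub k).one_mem, hμ⟩
end

section
/- Let n ≥ 2 and let a, b, c, d, e, f be integers with 2 ≤ a,b,c,d,e,f ≤ n satisfying a ≠ b, b ≠ c, c ≠ d, d ≠ e, e ≠ f, f ≠ a. If the product of transpositions (1,f)(1,e)(1,d)(1,c)(1,b)(1,a) equals the identity permutation in the symmetric group S_n, then a = c = e and b = d = f. -/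
open Equiv

/-- Six star transpositions, cyclically consecutive ones being distinct, multiply to the
identity only if they alternate between two of them. -/
theorem eq_of_swap_mul_eq_one {α : Type*} [DecidableEq α] {o a b c d e f : α}
    (ha : a ≠ o) (hb : b ≠ o) (hc : c ≠ o) (hd : d ≠ o) (he : e ≠ o) (hf : f ≠ o)
    (hab : a ≠ b) (hbc : b ≠ c) (hde : d ≠ e) (hef : e ≠ f) (hfa : f ≠ a)
    (h : swap o f * swap o e * swap o d * swap o c * swap o b * swap o a = 1) :
    a = c ∧ c = e ∧ b = d ∧ d = f := by
  have key (x : α) : swap o c (swap o b (swap o a x)) = swap o d (swap o e (swap o f x)) := by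
    have hx := DFunLike.congr_fun h x
    simp only [Perm.mul_apply, Perm.one_apply] at hx
    conv_rhs => rw [← hx]
    simp only [swap_apply_self]
  have ho := key o
  have hka := key a
  have hkb := key b
  have hkc := key c
  have hkd := key d
  have hke := key e
  have hkf := key f
  clear key h
  simp only [swap_apply_def] at *
  grind

/-- Let `2 ≤ a,b,c,d,e,f ≤ n` with `a ≠ b`, `b ≠ c`, `c ≠ d`, `d ≠ e`, `e ≠ f`, `f ≠ a`.
If `(1,f)(1,e)(1,d)(1,c)(1,b)(1,a) = id` in `S_n`, then `a = c = e` and `b = d = f`.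
(The `n`-point set `{1,…,n}` is modelled as `Fin n`, with the point `1` as `⟨0, _⟩`,
so `2 ≤ x ≤ n` becomes `x ≠ ⟨0, _⟩`.) -/
theorem transposition_lemma (n : ℕ) (hn : 2 ≤ n) (a b c d e f : Fin n)
    (ha : a ≠ ⟨0, by omega⟩) (hb : b ≠ ⟨0, by omega⟩) (hc : c ≠ ⟨0, by omega⟩)
    (hd : d ≠ ⟨0, by omega⟩) (he : e ≠ ⟨0, by omega⟩) (hf : f ≠ ⟨0, by omega⟩)
    (hab : a ≠ b) (hbc : b ≠ c) (hcd : c ≠ d) (hde : d ≠ e) (hef : e ≠ f) (hfa : f ≠ a)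
    (h : Equiv.swap ⟨0, by omega⟩ f * Equiv.swap ⟨0, by omega⟩ e *
        Equiv.swap ⟨0, by omega⟩ d * Equiv.swap ⟨0, by omega⟩ c *
        Equiv.swap ⟨0, by omega⟩ b * Equiv.swap ⟨0, by omega⟩ a = 1) :
    a = c ∧ c = e ∧ b = d ∧ d = f := by
  exact eq_of_swap_mul_eq_one ha hb hc hd he hf hab hbc hde hef hfa h
end

section
/- Let k ≥ 2, n ≥ k+2, and let u, v, w be vertices of S_{n,k} such that uv is a residual edge and vw is a star edge. Then there is exactly one alternating 6-cycle in S_{n,k} containing both edges uv and vw. -/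
open Equiv

theorem isResEdge_iff {n k : ℕ} [NeZero k] (u v : StarVertex n k) :
    IsResEdge u v ↔ u.1 0 ≠ v.1 0 ∧ ∀ j ≠ 0, u.1 j = v.1 j := by
  simp [IsResEdge, Fin.val_eq_zero_iff]

theorem isStarEdge_iff {n k : ℕ} [NeZero k] (u v : StarVertex n k) :
    IsStarEdge u v ↔ ∃ i ≠ 0, (v.1 0 = u.1 i ∧ v.1 i = u.1 0) ∧
      ∀ j ≠ 0, j ≠ i → v.1 j = u.1 j := by
  simp [IsStarEdge, Fin.val_eq_zero_iff]

/-- The vertex obtained by replacing the first entry of `w` by an unused symbol `a`. -/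
def replaceFirst {n k : ℕ} [NeZero k] (w : StarVertex n k) (a : Fin n)
    (ha : ∀ j ≠ 0, w.1 j ≠ a) : StarVertex n k :=
  ⟨Function.update w.1 0 a, by
    intro p q h
    have := @w.2 p q
    grind [Function.update_apply]⟩

/-- The vertex obtained by exchanging the entry of `w` in the first position with the
one in position `i`. -/
def swapFirst {n k : ℕ} [NeZero k] (w : StarVertex n k) (i : Fin k) : StarVertex n k :=
  ⟨w.1 ∘ Equiv.swap 0 i, w.2.comp (Equiv.swap 0 i).injective⟩

section

variable {n k : ℕ} [NeZero k]

theorem replaceFirst_zero (w : StarVertex n k) (a : Fin n) (ha : ∀ j ≠ 0, w.1 j ≠ a) :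
    (replaceFirst w a ha).1 0 = a := by
  simp [replaceFirst]

theorem replaceFirst_of_ne (w : StarVertex n k) (a : Fin n) (ha : ∀ j ≠ 0, w.1 j ≠ a)
    {j : Fin k} (hj : j ≠ 0) : (replaceFirst w a ha).1 j = w.1 j := by
  simp [replaceFirst, hj]

theorem swapFirst_zero (w : StarVertex n k) (i : Fin k) : (swapFirst w i).1 0 = w.1 i := by
  simp [swapFirst]

theorem swapFirst_self (w : StarVertex n k) (i : Fin k) : (swapFirst w i).1 i = w.1 0 := by
  simp [swapFirst]

theorem swapFirst_of_ne (w : StarVertex n k) {i j : Fin k} (hj : j ≠ 0) (hji : j ≠ i) :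
    (swapFirst w i).1 j = w.1 j := by
  simp [swapFirst, Equiv.swap_apply_of_ne_of_ne hj hji]

theorem exists_alternating_six_cycle {u v w : StarVertex n k}
    (huv : IsResEdge u v) (hvw : IsStarEdge v w) :
    ∃ x y z : StarVertex n k, [u, v, w, x, y, z].Pairwise (· ≠ ·) ∧
      IsResEdge w x ∧ IsStarEdge x y ∧ IsResEdge y z ∧ IsStarEdge z u := by
  obtain ⟨huv0, huv⟩ := (isResEdge_iff u v).1 huv
  obtain ⟨i, hi, ⟨hw0, hwi⟩, hw⟩ := (isStarEdge_iff v w).1 hvw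
  have hu (j) (hj : j ≠ 0) : u.1 j ≠ u.1 0 := fun h => hj (u.2 h)
  have hv (j) (hj : j ≠ 0) : v.1 j ≠ v.1 0 := fun h => hj (v.2 h)
  have ha (j) (hj : j ≠ 0) : w.1 j ≠ u.1 0 := by grind
  have hx0 := replaceFirst_zero w (u.1 0) ha
  have hx (j) (hj : j ≠ 0) := replaceFirst_of_ne w (u.1 0) ha hj
  set x := replaceFirst w (u.1 0) ha
  have hy0 := swapFirst_zero x i
  have hyi := swapFirst_self x i
  have hy (j) (hj : j ≠ 0) (hji : j ≠ i) := swapFirst_of_ne x hj hji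
  have hz0 := swapFirst_zero u i
  have hzi := swapFirst_self u i
  have hz (j) (hj : j ≠ 0) (hji : j ≠ i) := swapFirst_of_ne u hj hji
  refine ⟨x, swapFirst x i, swapFirst u i, ?_, ?_, ?_, ?_, ?_⟩
  · simp only [List.pairwise_cons, List.mem_cons, List.not_mem_nil, or_false]
    grind
  · rw [isResEdge_iff]
    grind
  · rw [isStarEdge_iff]
    exact ⟨i, hi, ⟨hy0, hyi⟩, hy⟩
  · rw [isResEdge_iff]
    grind
  · rw [isStarEdge_iff]
    exact ⟨i, hi, ⟨hzi.symm, hz0.symm⟩, fun j hj hji => (hz j hj hji).symm⟩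

/-- The remaining entries of an alternating 6-cycle: every star edge of the cycle exchanges
the same two positions. -/
theorem alternating_six_cycle_entries {u v w x y z : StarVertex n k} {i : Fin k}
    (hi : i ≠ 0) (huv : IsResEdge u v) (hw0 : w.1 0 = v.1 i) (hwi : w.1 i = v.1 0)
    (hw : ∀ j ≠ 0, j ≠ i → w.1 j = v.1 j) (hwx : IsResEdge w x) (hxy : IsStarEdge x y)
    (hyz : IsResEdge y z) (hzu : IsStarEdge z u) :
    x.1 = Function.update w.1 0 (u.1 0) ∧
      y.1 = Function.update (Function.update w.1 0 (v.1 0)) i (u.1 0) ∧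
      z.1 = Function.update (Function.update w.1 0 (u.1 i)) i (u.1 0) := by
  obtain ⟨huv0, huv⟩ := (isResEdge_iff u v).1 huv
  obtain ⟨hwx0, hwx⟩ := (isResEdge_iff w x).1 hwx
  obtain ⟨p, hp, ⟨hy0, hyp⟩, hy⟩ := (isStarEdge_iff x y).1 hxy
  obtain ⟨hyz0, hyz⟩ := (isResEdge_iff y z).1 hyz
  obtain ⟨q, hq, ⟨hu0, huq⟩, hu⟩ := (isStarEdge_iff z u).1 hzu
  have hv (j) (hj : j ≠ 0) : v.1 j ≠ v.1 0 := fun h => hj (v.2 h)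
  have hpi : p = i := by
    by_contra hne
    have hzi : z.1 i = v.1 0 := by grind
    have hqi : q = i := by grind
    grind
  subst p
  have hqi : q = i := by
    by_contra hne
    have := hu i hi (Ne.symm hne)
    grind
  subst q
  refine ⟨?_, ?_, ?_⟩ <;> funext j <;> grind [Function.update_apply]

end

/-- If `uv` is a residual edge and `vw` is a star edge of `S_{n,k}`, then there is a unique
alternating 6-cycle (edges alternately residual and star) containing `uv` and `vw`; the
cycle is `u ─ v ─ w ─ x ─ y ─ z ─ u` and is recorded by the triple `(x,y,z)` of its
remaining vertices. -/
theorem unique_alternating_six_cycle (n k : ℕ) (hk : 2 ≤ k) (hn : k + 2 ≤ n)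
    (u v w : StarVertex n k) (huv : IsResEdge u v) (hvw : IsStarEdge v w) :
    ∃! p : StarVertex n k × StarVertex n k × StarVertex n k,
      [u, v, w, p.1, p.2.1, p.2.2].Pairwise (· ≠ ·) ∧
      IsResEdge w p.1 ∧ IsStarEdge p.1 p.2.1 ∧ IsResEdge p.2.1 p.2.2 ∧
      IsStarEdge p.2.2 u := by
  have : NeZero k := ⟨by omega⟩
  obtain ⟨x, y, z, hne, hwx, hxy, hyz, hzu⟩ := exists_alternating_six_cycle huv hvw
  obtain ⟨i, hi, ⟨hw0, hwi⟩, hw⟩ := (isStarEdge_iff v w).1 hvw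
  obtain ⟨ex, ey, ez⟩ := alternating_six_cycle_entries hi huv hw0 hwi hw hwx hxy hyz hzu
  refine ⟨(x, y, z), ⟨hne, hwx, hxy, hyz, hzu⟩, ?_⟩
  rintro ⟨x', y', z'⟩ ⟨-, hwx', hxy', hyz', hzu'⟩
  obtain ⟨ex', ey', ez'⟩ := alternating_six_cycle_entries hi huv hw0 hwi hw hwx' hxy' hyz' hzu'
  exact Prod.ext (Subtype.ext (ex'.trans ex.symm))
    (Prod.ext (Subtype.ext (ey'.trans ey.symm)) (Subtype.ext (ez'.trans ez.symm)))
end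

section
/- Let k ≥ 2 and n ≥ k+2, and suppose G ≤ S_n × S_{k−1} is a subgroup such that the map G → V(S_{n,k}), (μ,ν) ↦ overline{μν⁻¹}, is bijective (equivalently, G acts regularly via φ on the vertices of S_{n,k}). Let H = {μ ∈ S_n : (μ,ν) ∈ G for some ν ∈ S_{k−1}} be the image of G under the projection to S_n. Then H is a k-homogeneous permutation group on {1,…,n}. -/
open Equiv

/-- Regularity makes every `k`-subset the image of the underlying set of the base vertex. -/
theorem exists_image_range_eVert_eq {n k : ℕ} (h : k ≤ n)
    (G : Subgroup (Equiv.Perm (Fin n) × ↥(SkSub k)))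
    (hsurj : Function.Surjective fun g : ↥G => phi n k g.1.1 g.1.2.1 (eVert n k h))
    (s : Finset (Fin n)) (hs : s.card = k) :
    ∃ μ ∈ Subgroup.map (MonoidHom.fst (Equiv.Perm (Fin n)) ↥(SkSub k)) G,
      μ '' Set.range (eVert n k h).1 = s := by
  obtain ⟨g, hg⟩ := hsurj ⟨s.orderEmbOfFin hs, (s.orderEmbOfFin hs).injective⟩
  refine ⟨g.1.1, ⟨g.1, g.2, rfl⟩, ?_⟩
  have hfun : (g.1.1 ∘ (eVert n k h).1) ∘ ⇑(g.1.2.1⁻¹) = s.orderEmbOfFin hs :=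
    congrArg Subtype.val hg
  rw [← Set.range_comp, ← Finset.range_orderEmbOfFin s hs, ← hfun,
    (Equiv.surjective _).range_comp]

/-- Suppose `G ≤ S_n × S_{k-1}` acts regularly (via `φ`) on the vertices of `S_{n,k}`,
i.e. `(μ,ν) ↦ overline{μν⁻¹}` is a bijection `G → V(S_{n,k})`. Then the image `H` of `G`
under the projection to `S_n` is `k`-homogeneous: it acts transitively on the `k`-element
subsets of the `n`-point set. -/
theorem image_k_homogeneous (n k : ℕ) (hk : 2 ≤ k) (hn : k + 2 ≤ n)
    (G : Subgroup (Equiv.Perm (Fin n) × ↥(SkSub k)))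
    (hreg : Function.Bijective
      fun g : ↥G => phi n k g.1.1 g.1.2.1 (eVert n k (by omega))) :
    ∀ s t : Finset (Fin n), s.card = k → t.card = k →
      ∃ μ ∈ Subgroup.map (MonoidHom.fst (Equiv.Perm (Fin n)) ↥(SkSub k)) G,
        Finset.image (⇑μ) s = t := by
  intro s t hs ht
  obtain ⟨μ, hμ, hμs⟩ := exists_image_range_eVert_eq (by omega) G hreg.surjective s hs
  obtain ⟨ρ, hρ, hρt⟩ := exists_image_range_eVert_eq (by omega) G hreg.surjective t ht
  refine ⟨ρ * μ⁻¹, mul_mem hρ (inv_mem hμ), Finset.coe_injective ?_⟩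
  rw [Finset.coe_image, ← hμs, ← hρt, ← Set.image_comp]
  congr 1
  ext x
  simp
end

section
/- Let k ≥ 2 and n ≥ k+3, suppose G ≤ S_n × S_{k−1} is a subgroup acting regularly (via φ) on the vertices of S_{n,k}, and let H ≤ S_n be the image of G under the projection to S_n. If H is k-transitive, then H is sharply k-transitive. -/
open Equiv

/-- Let `k ≥ 2`, `n ≥ k+3`, let `G ≤ S_n × S_{k-1}` act regularly (via `φ`) on the vertices
of `S_{n,k}`, and let `H` be the image of `G` under the projection to `S_n`. If `H` is
`k`-transitive, then `H` is sharply `k`-transitive. -/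
theorem k_transitive_implies_sharp (n k : ℕ) (hk : 2 ≤ k) (hn : k + 3 ≤ n)
    (G : Subgroup (Equiv.Perm (Fin n) × ↥(SkSub k)))
    (hreg : Function.Bijective
      fun g : ↥G => phi n k g.1.1 g.1.2.1 (eVert n k (by omega)))
    (htrans : IsMultTrans n k (Subgroup.map (MonoidHom.fst (Equiv.Perm (Fin n)) ↥(SkSub k)) G)) :
    IsSharplyMultTrans n k (Subgroup.map (MonoidHom.fst (Equiv.Perm (Fin n)) ↥(SkSub k)) G) := by
  intro a b ha hb
  obtain ⟨μ, hμ, hμb⟩ := htrans a b ha hb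
  have : Finite (StarVertex n k) := Subtype.finite
  let e := Equiv.ofBijective _ hreg
  let f : ↥G → StarVertex n k := fun g => ⟨fun j => g.1.1 (a j), g.1.1.injective.comp ha⟩
  have hsurj : Function.Surjective (f ∘ e.symm) := by
    intro c
    obtain ⟨_, ⟨g, hg, rfl⟩, hgc⟩ := htrans a c.1 ha c.2
    exact ⟨e ⟨g, hg⟩, (congrArg f (e.symm_apply_apply _)).trans (Subtype.ext (funext hgc))⟩
  have hinj : Function.Injective f := by
    have h := (Finite.injective_iff_surjective.mpr hsurj).comp e.injective
    simpa [Function.comp_def] using h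
  refine ⟨⟨μ, hμ⟩, hμb, ?_⟩
  rintro ⟨_, g', hg', rfl⟩ h'
  obtain ⟨g, hg, rfl⟩ := hμ
  have hgg : (⟨g', hg'⟩ : ↥G) = ⟨g, hg⟩ :=
    hinj (Subtype.ext (funext fun j => (h' j).trans (hμb j).symm))
  exact Subtype.ext (congrArg (fun x : ↥G => x.1.1) hgg)
end

section
/- Let k ≥ 2 and n ≥ k+3. If there exists a sharply k-transitive subgroup H of the symmetric group S_n, then the (n,k)-star graph S_{n,k} is a Cayley graph. -/
open Equiv

/-- Sabidussi's criterion: a graph on which a finite group acts regularly by automorphisms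
is a Cayley graph. -/
theorem isCayleyGraph_of_regular_action {V : Type*} (Γ : SimpleGraph V) (G : Type) [Group G]
    [Finite G] [MulAction G V] (hΓ : ∀ (g : G) (u w : V), Γ.Adj (g • u) (g • w) ↔ Γ.Adj u w)
    (v : V) (hv : Function.Bijective fun g : G => g • v) : IsCayleyGraph Γ := by
  have hadj (g h : G) : Γ.Adj v ((g⁻¹ * h) • v) ↔ Γ.Adj (g • v) (h • v) := by
    rw [← hΓ g, smul_smul, mul_inv_cancel_left]
  refine ⟨G, inferInstance, Fintype.ofFinite G, {g | Γ.Adj v (g • v)}, by simp, ?_,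
    ⟨RelIso.symm ⟨Equiv.ofBijective _ hv, ?_⟩⟩⟩
  · intro g hg
    have := hadj g 1
    rw [mul_one, one_smul, Γ.adj_comm (g • v)] at this
    exact this.2 hg
  · intro g h
    simp only [Equiv.ofBijective_apply, SimpleGraph.fromRel_adj, Set.mem_ofPred_eq, hadj,
      Γ.adj_comm (h • v), or_self]
    exact ⟨fun H => ⟨fun e => H.ne (by rw [e]), H⟩, And.right⟩

/-- Permutations of the symbols act on the vertices of the `(n,k)`-star graph entrywise. -/
instance starVertexMulAction (n k : ℕ) : MulAction (Equiv.Perm (Fin n)) (StarVertex n k) where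
  smul μ := phi n k μ 1
  one_smul _ := rfl
  mul_smul _ _ _ := rfl

theorem coe_smul_starVertex {n k : ℕ} (μ : Equiv.Perm (Fin n)) (u : StarVertex n k)
    (j : Fin k) : (μ • u).1 j = μ (u.1 j) := rfl

theorem isResEdge_smul_iff {n k : ℕ} (μ : Equiv.Perm (Fin n)) (u v : StarVertex n k) :
    IsResEdge (μ • u) (μ • v) ↔ IsResEdge u v := by
  simp [IsResEdge, coe_smul_starVertex]

theorem isStarEdge_smul_iff {n k : ℕ} (μ : Equiv.Perm (Fin n)) (u v : StarVertex n k) :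
    IsStarEdge (μ • u) (μ • v) ↔ IsStarEdge u v := by
  simp [IsStarEdge, coe_smul_starVertex]

theorem starGraph_adj_smul_iff {n k : ℕ} (μ : Equiv.Perm (Fin n)) (u v : StarVertex n k) :
    (starGraph n k).Adj (μ • u) (μ • v) ↔ (starGraph n k).Adj u v := by
  simp [starGraph, isResEdge_smul_iff, isStarEdge_smul_iff]

/-- Let `k ≥ 2` and `n ≥ k+3`. If there exists a sharply `k`-transitive subgroup `H` of
the symmetric group `S_n`, then `S_{n,k}` is a Cayley graph. -/
theorem sharply_k_transitive_implies_cayley (n k : ℕ) (hk : 2 ≤ k) (hn : k + 3 ≤ n)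
    (H : Subgroup (Equiv.Perm (Fin n))) (hH : IsSharplyMultTrans n k H) :
    IsCayleyGraph (starGraph n k) := by
  refine isCayleyGraph_of_regular_action _ H (fun g => starGraph_adj_smul_iff (g : Perm (Fin n)))
    (eVert n k (by omega)) ?_
  refine (Function.bijective_iff_existsUnique _).2 fun w => ?_
  obtain ⟨μ, hμ, huniq⟩ := hH (eVert n k (by omega)).1 w.1 (eVert n k _).2 w.2
  exact ⟨μ, Subtype.ext (funext hμ),
    fun g hg => huniq g fun j => congrFun (congrArg Subtype.val hg) j⟩
end
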